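/- Let ν > 0. Then: (i) the function u(x) = (cosh x)^{−ν} is strictly positive, belongs to L²(ℝ), is smooth, and satisfies −u″(x) − ν(ν+1)sech²(x) u(x) = −ν² u(x) for all x ∈ ℝ; (ii) for every integer k with 1 ≤ k ≤ ⌈ν⌉, the number −(ν−k+1)² is an eigenvalue of the Pöschl–Teller Schrödinger operator −d²/dx² − ν(ν+1)sech²(x) on L²(ℝ); (iii) with g(x) = −ν tanh(x) one has ν(ν+1)sech²(x) + 2g′(x) = ν(ν−1)sech²(x) for all x, i.e. the commutation method maps the Pöschl–Teller potential with parameter ν to the one with parameter ν−1. -/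

import Mathlib

open MeasureTheory Real Filter Set
open scoped Topology

/-- `E` is an eigenvalue of the Schrödinger operator `-d²/dx² - W` on `L²(ℝ)`:
there is a nonzero `ψ ∈ L²(ℝ)`, continuously differentiable with `ψ'` locally
absolutely continuous (encoded via a locally integrable a.e.-derivative `ψ''`),
such that `-ψ'' - Wψ = Eψ` almost everywhere. -/
def IsEigenvalue (W : ℝ → ℝ) (E : ℝ) : Prop :=
  ∃ ψ ψ'' : ℝ → ℝ, ψ ≠ 0 ∧ MemLp ψ 2 (volume : Measure ℝ) ∧ ContDiff ℝ 1 ψ ∧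
    (∀ a b : ℝ, IntervalIntegrable ψ'' volume a b ∧
      ∫ x in a..b, ψ'' x = deriv ψ b - deriv ψ a) ∧
    (∀ᵐ x : ℝ ∂volume, -ψ'' x - W x * ψ x = E * ψ x)

open Polynomial in
noncomputable def ptD (μ : ℝ) (P : Polynomial ℝ) : Polynomial ℝ :=
  (1 - X ^ 2) * derivative P - C μ * X * P

open Polynomial in
lemma ptD_exists (μ : ℝ) (hμ : 0 < μ) (n : ℕ) : ∃ P : Polynomial ℝ, 0 < P.eval 1 ∧
    ptD μ (ptD μ P) + C ((μ + n) * (μ + n + 1)) * (1 - X ^ 2) * P = C (μ ^ 2) * P := by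
  induction n with
  | zero =>
    refine ⟨1, by simp, ?_⟩
    simp [ptD]
    ring
  | succ n ih =>
    obtain ⟨P, hP, h⟩ := ih
    obtain ⟨l, hl⟩ : ∃ l : ℝ, l = μ + n + 1 := ⟨_, rfl⟩
    have e1 : μ + ((n + 1 : ℕ) : ℝ) = l := by push_cast; rw [hl]; ring
    have e2 : μ + (n : ℝ) = l - 1 := by rw [hl]; ring
    have hl0 : 0 < l := by rw [hl]; positivity
    rw [e1]
    rw [e2] at h
    have D1 : ∀ Q, ptD μ (X * Q) = (1 - X ^ 2) * Q + X * ptD μ Q := by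
      intro Q; simp [ptD]; ring
    have D2 : ∀ Q, ptD μ ((1 - X ^ 2) * Q) = -2 * X * (1 - X ^ 2) * Q + (1 - X ^ 2) * ptD μ Q := by
      intro Q; simp [ptD]; ring
    have D3 : ∀ Q R, ptD μ (Q - R) = ptD μ Q - ptD μ R := by
      intro Q R; simp [ptD]; ring
    have D5 : ∀ Q R, ptD μ (Q + R) = ptD μ Q + ptD μ R := by
      intro Q R; simp [ptD]; ring
    have D4 : ∀ c Q, ptD μ (C c * Q) = C c * ptD μ Q := by
      intro c Q; simp [ptD]; ring
    refine ⟨C l * (X * P) - ptD μ P, ?_, ?_⟩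
    · simp [ptD]
      positivity
    · have h' : ptD μ (ptD μ P) = C (μ ^ 2) * P - C ((l - 1) * (l - 1 + 1)) * ((1 - X ^ 2) * P) := by
        linear_combination h
      simp only [D3, D4, D1, D2, D5, h']
      simp only [C_mul, C_add, C_sub, C_1, C_pow]
      ring

lemma pt_tanh_deriv (x : ℝ) : HasDerivAt Real.tanh (1 - Real.tanh x ^ 2) x := by
  have hc : Real.cosh x ≠ 0 := (Real.cosh_pos x).ne'
  have h := (Real.hasDerivAt_sinh x).div (Real.hasDerivAt_cosh x) hc
  have e : Real.tanh = Real.sinh / Real.cosh := by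
    funext y; simp [Real.tanh_eq_sinh_div_cosh]
  rw [e]
  refine h.congr_deriv ?_
  rw [Pi.div_apply]
  field_simp

lemma pt_sech (x : ℝ) : (1 / Real.cosh x) ^ 2 = 1 - Real.tanh x ^ 2 := by
  have hc : Real.cosh x ≠ 0 := (Real.cosh_pos x).ne'
  rw [Real.tanh_eq_sinh_div_cosh]
  field_simp
  linarith [Real.cosh_sq x]

lemma pt_u_deriv (μ x : ℝ) : HasDerivAt (fun y : ℝ => Real.cosh y ^ (-μ))
    (-μ * Real.tanh x * Real.cosh x ^ (-μ)) x := by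
  have hc : 0 < Real.cosh x := Real.cosh_pos x
  convert (Real.hasDerivAt_cosh x).rpow_const (p := -μ) (Or.inl hc.ne') using 1
  rw [Real.tanh_eq_sinh_div_cosh, Real.rpow_sub_one hc.ne']
  field_simp

open Polynomial in
lemma pt_P_deriv (μ : ℝ) (P : Polynomial ℝ) (x : ℝ) :
    HasDerivAt (fun y : ℝ => P.eval (Real.tanh y) * Real.cosh y ^ (-μ))
    ((ptD μ P).eval (Real.tanh x) * Real.cosh x ^ (-μ)) x := by
  have h := ((P.hasDerivAt (Real.tanh x)).comp x (pt_tanh_deriv x)).mul (pt_u_deriv μ x)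
  refine h.congr_deriv ?_
  simp [ptD]
  ring

lemma pt_memLp (μ : ℝ) (hμ : 0 < μ) :
    MemLp (fun x : ℝ => Real.cosh x ^ (-μ)) 2 (volume : Measure ℝ) := by
  have hcont : Continuous (fun x : ℝ => Real.cosh x ^ (-μ)) :=
    continuous_iff_continuousAt.2 fun x => (pt_u_deriv μ x).continuousAt
  rw [memLp_two_iff_integrable_sq hcont.aestronglyMeasurable]
  have hb : ∀ (s x : ℝ), Real.exp (s * x) ≤ 2 * Real.cosh x →
      ‖(Real.cosh x ^ (-μ)) ^ 2‖ ≤ 2 ^ (2 * μ) * Real.exp (-(2 * μ) * (s * x)) := by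
    intro s x h
    have hc : 0 < Real.cosh x := Real.cosh_pos x
    have h1 : (2 * Real.cosh x) ^ (-(2 * μ)) ≤ (Real.exp (s * x)) ^ (-(2 * μ)) :=
      Real.rpow_le_rpow_of_nonpos (Real.exp_pos _) h (by linarith)
    rw [Real.mul_rpow (by norm_num) hc.le, ← Real.exp_mul, Real.rpow_neg (by norm_num)] at h1
    have h2 : (Real.cosh x ^ (-μ)) ^ 2 = Real.cosh x ^ (-(2 * μ)) := by
      rw [← Real.rpow_natCast, ← Real.rpow_mul hc.le]; congr 1; push_cast; ring
    rw [Real.norm_of_nonneg (by positivity), h2]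
    have h3 : (0 : ℝ) < 2 ^ (2 * μ) := by positivity
    rw [inv_mul_le_iff₀ h3] at h1
    rwa [mul_comm (-(2 * μ)) (s * x)]
  have hm : AEStronglyMeasurable (fun x : ℝ => (Real.cosh x ^ (-μ)) ^ 2) volume :=
    (hcont.pow 2).aestronglyMeasurable
  have hp : ∀ x : ℝ, Real.exp x ≤ 2 * Real.cosh x := fun x => by
    rw [Real.cosh_eq]; linarith [Real.exp_pos (-x)]
  have hn : ∀ x : ℝ, Real.exp (-x) ≤ 2 * Real.cosh x := fun x => by
    rw [Real.cosh_eq]; linarith [Real.exp_pos (x)]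
  rw [← integrableOn_univ, ← Set.Iic_union_Ioi (a := (0 : ℝ)), integrableOn_union]
  constructor
  · refine Integrable.mono' (g := fun x => 2 ^ (2 * μ) * Real.exp ((2 * μ) * x)) ?_ hm.restrict ?_
    · exact (integrableOn_exp_mul_Iic (by linarith) 0).const_mul _
    · refine Filter.Eventually.of_forall fun x => ?_
      have := hb (-1) x (by simpa using hn x)
      convert this using 3
      ring
  · refine Integrable.mono' (g := fun x => 2 ^ (2 * μ) * Real.exp (-(2 * μ) * x)) ?_ hm.restrict ?_
    · exact (integrableOn_exp_mul_Ioi (by linarith) 0).const_mul _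
    · refine Filter.Eventually.of_forall fun x => ?_
      have := hb 1 x (by simpa using hp x)
      convert this using 3
      ring

lemma pt_P_cont (μ : ℝ) (P : Polynomial ℝ) :
    Continuous (fun y : ℝ => P.eval (Real.tanh y) * Real.cosh y ^ (-μ)) :=
  continuous_iff_continuousAt.2 fun x => (pt_P_deriv μ P x).continuousAt

lemma pt_P_memLp (μ : ℝ) (hμ : 0 < μ) (P : Polynomial ℝ) :
    MemLp (fun y : ℝ => P.eval (Real.tanh y) * Real.cosh y ^ (-μ)) 2 (volume : Measure ℝ) := by
  obtain ⟨c, hc⟩ := (isCompact_Icc (a := (-1 : ℝ)) (b := 1)).exists_bound_of_continuousOn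
    P.continuous.continuousOn
  refine (pt_memLp μ hμ).of_le_mul (c := c) (pt_P_cont μ P).aestronglyMeasurable
    (Filter.Eventually.of_forall fun x => ?_)
  rw [norm_mul]
  refine mul_le_mul_of_nonneg_right (hc _ ?_) (norm_nonneg _)
  have := Real.tanh_bijOn.mapsTo (Set.mem_univ x)
  exact ⟨this.1.le, this.2.le⟩

lemma pt_deriv_eq (μ : ℝ) (P : Polynomial ℝ) :
    deriv (fun y : ℝ => P.eval (Real.tanh y) * Real.cosh y ^ (-μ)) =
      fun y : ℝ => (ptD μ P).eval (Real.tanh y) * Real.cosh y ^ (-μ) :=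
  funext fun x => (pt_P_deriv μ P x).deriv

lemma pt_eigen (μ : ℝ) (hμ : 0 < μ) (n : ℕ) :
    IsEigenvalue (fun x => (μ + n) * (μ + n + 1) * (1 / Real.cosh x) ^ 2) (-μ ^ 2) := by
  obtain ⟨P, hP, h⟩ := ptD_exists μ hμ n
  refine ⟨fun y => P.eval (Real.tanh y) * Real.cosh y ^ (-μ),
    fun y => (ptD μ (ptD μ P)).eval (Real.tanh y) * Real.cosh y ^ (-μ), ?_, pt_P_memLp μ hμ P,
    ?_, ?_, ?_⟩
  · intro h0
    have : P = 0 := by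
      refine Polynomial.eq_zero_of_infinite_isRoot P
        ((Set.infinite_range_of_injective Real.tanh_injective).mono ?_)
      rintro _ ⟨x, rfl⟩
      have hx := congrFun h0 x
      simpa [Polynomial.IsRoot, (Real.rpow_pos_of_pos (Real.cosh_pos x) (-μ)).ne'] using hx
    simp [this] at hP
  · rw [contDiff_one_iff_deriv, pt_deriv_eq]
    exact ⟨fun x => (pt_P_deriv μ P x).differentiableAt, pt_P_cont μ _⟩
  · intro a b
    have hi := (pt_P_cont μ (ptD μ (ptD μ P))).intervalIntegrable (μ := volume) a b
    refine ⟨hi, ?_⟩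
    rw [pt_deriv_eq]
    exact intervalIntegral.integral_eq_sub_of_hasDerivAt (fun x _ => pt_P_deriv μ _ x) hi
  · refine Filter.Eventually.of_forall fun x => ?_
    have hx := congrArg (Polynomial.eval (Real.tanh x)) h
    simp only [Polynomial.eval_add, Polynomial.eval_mul, Polynomial.eval_C, Polynomial.eval_sub,
      Polynomial.eval_one, Polynomial.eval_pow, Polynomial.eval_X] at hx
    simp only [pt_sech]
    linear_combination (-Real.cosh x ^ (-μ)) * hx

theorem poschl_teller_explicit_factorisation
    (ν : ℝ) (hν : 0 < ν) :
    -- (i) the ground state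
    ((∀ x : ℝ, 0 < Real.cosh x ^ (-ν)) ∧
      MemLp (fun x : ℝ => Real.cosh x ^ (-ν)) 2 (volume : Measure ℝ) ∧
      ContDiff ℝ (⊤ : ℕ∞) (fun x : ℝ => Real.cosh x ^ (-ν)) ∧
      (∀ x : ℝ,
        -(deriv (deriv (fun y : ℝ => Real.cosh y ^ (-ν))) x)
            - ν * (ν + 1) * (1 / Real.cosh x) ^ 2 * Real.cosh x ^ (-ν)
          = -ν ^ 2 * Real.cosh x ^ (-ν))) ∧
    -- (ii) the eigenvalues
    (∀ k : ℕ, 1 ≤ k → k ≤ Nat.ceil ν →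
      IsEigenvalue (fun x => ν * (ν + 1) * (1 / Real.cosh x) ^ 2)
        (-(ν - k + 1) ^ 2)) ∧
    -- (iii) the commutation step lowers the parameter by one
    (∀ x : ℝ,
      ν * (ν + 1) * (1 / Real.cosh x) ^ 2
          + 2 * deriv (fun y : ℝ => -ν * Real.tanh y) x
        = ν * (ν - 1) * (1 / Real.cosh x) ^ 2) := by
  refine ⟨⟨fun x => Real.rpow_pos_of_pos (Real.cosh_pos x) _, pt_memLp ν hν, ?_, ?_⟩, ?_, ?_⟩
  · exact Real.contDiff_cosh.rpow_const_of_ne fun x => (Real.cosh_pos x).ne'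
  · intro x
    have h := pt_deriv_eq ν 1
    have h2 := pt_deriv_eq ν (ptD ν 1)
    simp only [Polynomial.eval_one, one_mul] at h
    rw [h, h2, pt_sech]
    simp [ptD]
    ring
  · intro k hk1 hk
    obtain ⟨n, rfl⟩ : ∃ n, k = n + 1 := ⟨k - 1, by omega⟩
    have hlt : (n : ℝ) < ν := Nat.lt_ceil.1 (by omega)
    have h := pt_eigen (ν - n) (by linarith) n
    have e : ν - ((n + 1 : ℕ) : ℝ) + 1 = ν - n := by push_cast; ring
    rw [e]
    simpa using h
  · intro x
    rw [((pt_tanh_deriv x).const_mul (-ν)).deriv, pt_sech]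
    ring
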